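/- Let F ∈ H²(𝔻) be an inner function on the complex unit disk 𝔻, identified with 𝔹_i ⊂ 𝔹. Then the slice regular extension f = ext(F) is an inner function of H²(𝔹). -/

import Mathlib

open MeasureTheory Filter Topology
open scoped ENNReal Classical

noncomputable section

/-! ### Basic quaternionic notions -/

instance : MeasurableSpace (Quaternion ℝ) := borel _
instance : BorelSpace (Quaternion ℝ) := ⟨rfl⟩

/-- The 2-sphere `𝕊` of quaternionic imaginary units. -/
def USphere : Set (Quaternion ℝ) := {q | q ^ 2 = -1}

/-- The open quaternionic unit ball `𝔹`. -/
def QBall : Set (Quaternion ℝ) := {q | ‖q‖ < 1}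

/-- The slice `L_I = ℝ + ℝI` through an imaginary unit `I`. -/
def sliceSet (I : Quaternion ℝ) : Set (Quaternion ℝ) :=
  {q | ∃ x y : ℝ, q = (x : Quaternion ℝ) + y • I}

/-- The point `e^{tI} = cos t + (sin t) I` of the boundary circle `∂𝔹_I`. -/
def ptOn (I : Quaternion ℝ) (t : ℝ) : Quaternion ℝ :=
  ((Real.cos t : ℝ) : Quaternion ℝ) + Real.sin t • I

/-- Slice regularity on the unit ball: on every slice the restriction of `f` has partial
derivatives satisfying the Cauchy–Riemann equation `∂f/∂x + I ∂f/∂y = 0`. -/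
def SliceRegular (f : Quaternion ℝ → Quaternion ℝ) : Prop :=
  ∀ I ∈ USphere, ∀ x y : ℝ, ((x : Quaternion ℝ) + y • I) ∈ QBall →
    ∃ fx fy : Quaternion ℝ,
      HasDerivAt (fun s : ℝ => f ((s : Quaternion ℝ) + y • I)) fx x ∧
      HasDerivAt (fun t : ℝ => f ((x : Quaternion ℝ) + t • I)) fy y ∧
      fx + I * fy = 0

/-! ### The Hardy space `H²(𝔹)` via power series coefficients.
A slice regular function on `𝔹` is identified with its coefficient sequence
`a : ℕ → ℍ`, the function being `q ↦ ∑ qⁿ aₙ`. -/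

/-- Membership in `H²(𝔹)`: square-summable coefficients. -/
def MemH2 (a : ℕ → Quaternion ℝ) : Prop := Summable (fun n => ‖a n‖ ^ 2)

/-- Evaluation of the power series `q ↦ ∑ qⁿ aₙ`. -/
def evalS (a : ℕ → Quaternion ℝ) (q : Quaternion ℝ) : Quaternion ℝ := ∑' n, q ^ n * a n

/-- The `*`-product (slice product) on coefficient sequences. -/
def sProd (a b : ℕ → Quaternion ℝ) : ℕ → Quaternion ℝ :=
  fun n => ∑ k ∈ Finset.range (n + 1), a k * b (n - k)

/-- The regular conjugate `fᶜ`. -/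
def conjS (a : ℕ → Quaternion ℝ) : ℕ → Quaternion ℝ := fun n => star (a n)

/-- The symmetrization `fˢ = f * fᶜ`. -/
def symmS (a : ℕ → Quaternion ℝ) : ℕ → Quaternion ℝ := sProd a (conjS a)

/-- The squared `H²` norm `∑ ‖aₙ‖²`. -/
def h2normSq (a : ℕ → Quaternion ℝ) : ℝ := ∑' n, ‖a n‖ ^ 2

/-- The `H²` norm. -/
def h2norm (a : ℕ → Quaternion ℝ) : ℝ := Real.sqrt (h2normSq a)

/-- The (right) quaternionic inner product `⟨f,g⟩ = ∑ conj(bₙ) aₙ` of `H²(𝔹)`. -/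
def h2inner (a b : ℕ → Quaternion ℝ) : Quaternion ℝ := ∑' n, star (b n) * a n

/-- Squared `H²`-distance of two coefficient sequences (valued in `ℝ≥0∞`). -/
def h2distSq (a b : ℕ → Quaternion ℝ) : ℝ≥0∞ := ∑' n, (‖a n - b n‖₊ : ℝ≥0∞) ^ 2

/-- The boundary value function of `f ∈ H²(𝔹)`, given by the radial limit where it exists. -/
def bdval (a : ℕ → Quaternion ℝ) (q : Quaternion ℝ) : Quaternion ℝ :=
  if h : ∃ L, Tendsto (fun r : ℝ => evalS a ((r : Quaternion ℝ) * q)) (𝓝[<] (1 : ℝ)) (𝓝 L)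
  then h.choose else 0

/-! ### The measure `Σ` on `∂𝔹` with `dΣ(e^{tI}) = dσ(I) dt`. -/

/-- The normalized area measure `σ` on the sphere `𝕊` of imaginary units
(2-dimensional Hausdorff measure, normalized so that `σ(𝕊) = 1`). -/
def sphMeasure : Measure (Quaternion ℝ) := (μH[2] USphere)⁻¹ • (μH[2]).restrict USphere

/-- The measure `Σ` on `∂𝔹`, `dΣ(e^{tI}) = dσ(I) dt`, normalized so `Σ(∂𝔹) = 1`. -/
def SigmaBd : Measure (Quaternion ℝ) :=
  (ENNReal.ofReal (2 * Real.pi))⁻¹ •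
    Measure.map (fun p : ℝ × Quaternion ℝ => ptOn p.2 p.1)
      ((volume.restrict (Set.Ico 0 (2 * Real.pi))).prod sphMeasure)

/-! ### Inner, outer, cyclic -/

/-- `f ∈ H^∞(𝔹)`: a bounded function of `H²(𝔹)`. -/
def MemHinf (a : ℕ → Quaternion ℝ) : Prop :=
  MemH2 a ∧ ∃ C : ℝ, ∀ q ∈ QBall, ‖evalS a q‖ ≤ C

/-- The `H^∞` norm: the sup of `‖f‖` on the ball. -/
def hInfNorm (a : ℕ → Quaternion ℝ) : ℝ := sSup ((fun q => ‖evalS a q‖) '' QBall)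

/-- `f` is inner: `f ∈ H^∞(𝔹)`, `‖f‖ ≤ 1` on `𝔹` and `‖f‖ = 1` `Σ`-a.e. on `∂𝔹`. -/
def IsInnerQ (a : ℕ → Quaternion ℝ) : Prop :=
  MemH2 a ∧ (∀ q ∈ QBall, ‖evalS a q‖ ≤ 1) ∧ (∀ᵐ q ∂SigmaBd, ‖bdval a q‖ = 1)

/-- `g` is outer: whenever `f ∈ H²(𝔹)` has the same boundary modulus `Σ`-a.e.,
then `‖g‖ ≥ ‖f‖` throughout `𝔹`. -/
def IsOuterQ (g : ℕ → Quaternion ℝ) : Prop :=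
  MemH2 g ∧ ∀ f, MemH2 f → (∀ᵐ q ∂SigmaBd, ‖bdval g q‖ = ‖bdval f q‖) →
    ∀ q ∈ QBall, ‖evalS f q‖ ≤ ‖evalS g q‖

/-- Quaternionic polynomials (finitely supported coefficient sequences). -/
def IsPolyQ (p : ℕ → Quaternion ℝ) : Prop := ∃ N, ∀ n > N, p n = 0

/-- Quaternionic polynomials of degree at most `n` (the space `𝒫_n`). -/
def IsPolyDeg (p : ℕ → Quaternion ℝ) (n : ℕ) : Prop := ∀ m > n, p m = 0

/-- The coefficient sequence of the monomial `qᵏ`. -/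
def qpow (k : ℕ) : ℕ → Quaternion ℝ := fun n => if n = k then 1 else 0

/-- The coefficient sequence of a constant function. -/
def constS (c : Quaternion ℝ) : ℕ → Quaternion ℝ := fun n => if n = 0 then c else 0

/-- The coefficient sequence of the constant function `1`. -/
def oneS : ℕ → Quaternion ℝ := constS 1

/-- The invariant subspace `[g]`: the `H²`-closure of `{g * p : p polynomial}`,
i.e. of the right span of `{qⁿ * g : n ≥ 0}`. -/
def InvSub (g : ℕ → Quaternion ℝ) : Set (ℕ → Quaternion ℝ) :=
  {h | MemH2 h ∧ ∀ ε : ℝ≥0∞, 0 < ε → ∃ p, IsPolyQ p ∧ h2distSq (sProd g p) h < ε}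

/-- `g` is cyclic: `[g] = H²(𝔹)`. -/
def IsCyclicQ (g : ℕ → Quaternion ℝ) : Prop :=
  MemH2 g ∧ ∀ h, MemH2 h → h ∈ InvSub g

/-! ### Bilateral (slice `L²`) series, used for boundary products -/

/-- Bilateral coefficients of `f̃(q) = f(q̄)` on `∂𝔹`: `Σ_{n ≤ 0} qⁿ a_{-n}`. -/
def tildeZ (a : ℕ → Quaternion ℝ) : ℤ → Quaternion ℝ :=
  fun k => if k ≤ 0 then a (-k).toNat else 0

/-- Bilateral coefficients of `fᶜ` on `∂𝔹`. -/
def conjZ (a : ℕ → Quaternion ℝ) : ℤ → Quaternion ℝ :=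
  fun k => if 0 ≤ k then star (a k.toNat) else 0

/-- The `*`-product of two slice `L²` functions on the boundary, on coefficients. -/
def convZ (c b : ℤ → Quaternion ℝ) : ℤ → Quaternion ℝ := fun n => ∑' k : ℤ, c k * b (n - k)

/-- Evaluation of a bilateral series `q ↦ ∑_{n ∈ ℤ} qⁿ dₙ`. -/
def evalZ (d : ℤ → Quaternion ℝ) (q : Quaternion ℝ) : Quaternion ℝ := ∑' n : ℤ, q ^ n * d n

/-- The slice inner product `⟨qᵏ * f, f⟩_I = (1/2π)∫₀^{2π} conj(f(e^{θI})) (e^{θI})ᵏ f(e^{θI}) dθ`,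
computed with boundary values; note `(qᵏ * f)(q) = qᵏ f(q)` pointwise. -/
def sliceInnerPow (a : ℕ → Quaternion ℝ) (I : Quaternion ℝ) (k : ℕ) : Quaternion ℝ :=
  (2 * Real.pi)⁻¹ •
    ∫ t in Set.Ico 0 (2 * Real.pi), star (bdval a (ptOn I t)) * ((ptOn I t) ^ k * bdval a (ptOn I t))

/-! ### Complex Hardy space `H²(𝔻)` notions (for slice restrictions) -/

/-- Membership in the complex Hardy space `H²(𝔻)` via coefficients. -/
def CMemH2 (c : ℕ → ℂ) : Prop := Summable (fun n => ‖c n‖ ^ 2)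

/-- Evaluation of a complex power series. -/
def cEval (c : ℕ → ℂ) (z : ℂ) : ℂ := ∑' n, z ^ n * c n

/-- Cauchy product of complex coefficient sequences. -/
def cConv (c d : ℕ → ℂ) : ℕ → ℂ := fun n => ∑ k ∈ Finset.range (n + 1), c k * d (n - k)

/-- Squared `H²(𝔻)` distance. -/
def cDistSq (c d : ℕ → ℂ) : ℝ≥0∞ := ∑' n, (‖c n - d n‖₊ : ℝ≥0∞) ^ 2

/-- Radial boundary values of a complex `H²` function. -/
def cBdval (c : ℕ → ℂ) (z : ℂ) : ℂ :=
  if h : ∃ L, Tendsto (fun r : ℝ => cEval c ((r : ℂ) * z)) (𝓝[<] (1 : ℝ)) (𝓝 L)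
  then h.choose else 0

/-- Lebesgue measure on the unit circle `∂𝔻` (parametrized by `θ ∈ [0, 2π)`). -/
def circleM : Measure ℂ :=
  Measure.map (fun t : ℝ => Complex.exp (t * Complex.I)) (volume.restrict (Set.Ico 0 (2 * Real.pi)))

/-- Cyclicity in `H²(𝔻)`: polynomial multiples of `c` are dense. -/
def CIsCyclic (c : ℕ → ℂ) : Prop :=
  CMemH2 c ∧ ∀ h, CMemH2 h → ∀ ε : ℝ≥0∞, 0 < ε →
    ∃ p : ℕ → ℂ, (∃ N, ∀ n > N, p n = 0) ∧ cDistSq (cConv c p) h < ε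

/-- Outerness in `H²(𝔻)` (in the sense matching Definition 2.10 of the paper). -/
def CIsOuter (c : ℕ → ℂ) : Prop :=
  CMemH2 c ∧ ∀ h, CMemH2 h →
    (∀ᵐ z ∂circleM, ‖cBdval c z‖ = ‖cBdval h z‖) →
    ∀ z ∈ Metric.ball (0 : ℂ) 1, ‖cEval h z‖ ≤ ‖cEval c z‖

/-- Complex coordinates of a point of the slice `L_I`: if `p = x + yI` then
`sliceToC I p = x + iy`. -/
def sliceToC (I : Quaternion ℝ) (p : Quaternion ℝ) : ℂ := ⟨p.re, -(p * I).re⟩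

/-- The quaternion `i`. -/
def qI : Quaternion ℝ := ⟨0, 1, 0, 0⟩

/-- The embedding of `ℂ = L_i` into the quaternions. -/
def cToQ (z : ℂ) : Quaternion ℝ := (z.re : Quaternion ℝ) + z.im • qI

/-- The imaginary unit `I_ω` identified by `ω` (any imaginary unit if `ω` is real). -/
def Iu (ω : Quaternion ℝ) : Quaternion ℝ := if ω.im = 0 then qI else ‖ω.im‖⁻¹ • ω.im

/-! ### Optimal approximants -/

/-- `p` is an optimal approximant of degree `n` of `f^{-*}`: `p ∈ 𝒫_n` minimizes
`‖f * p - 1‖_{H²}` among all `p ∈ 𝒫_n`. -/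
def IsOptApprox (a : ℕ → Quaternion ℝ) (n : ℕ) (p : ℕ → Quaternion ℝ) : Prop :=
  IsPolyDeg p n ∧ ∀ r, IsPolyDeg r n → h2distSq (sProd a p) oneS ≤ h2distSq (sProd a r) oneS

end

noncomputable section ExtInner

@[simp] lemma qI_re : qI.re = 0 := rfl
@[simp] lemma qI_imI : qI.imI = 1 := rfl
@[simp] lemma qI_imJ : qI.imJ = 0 := rfl
@[simp] lemma qI_imK : qI.imK = 0 := rfl
@[simp] lemma oneQ_re : (1 : Quaternion ℝ).re = 1 := rfl
@[simp] lemma oneQ_imI : (1 : Quaternion ℝ).imI = 0 := rfl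
@[simp] lemma oneQ_imJ : (1 : Quaternion ℝ).imJ = 0 := rfl
@[simp] lemma oneQ_imK : (1 : Quaternion ℝ).imK = 0 := rfl

lemma cToQ_eq (z : ℂ) : cToQ z = (z : Quaternion ℝ) := by
  ext <;> simp [cToQ]

lemma usphere_iff {I : Quaternion ℝ} (h : I ∈ USphere) :
    I.re = 0 ∧ I.imI ^ 2 + I.imJ ^ 2 + I.imK ^ 2 = 1 := by
  have h : I ^ 2 = -1 := h
  rw [pow_two] at h
  have h0 := congrArg QuaternionAlgebra.re h
  have h1 := congrArg QuaternionAlgebra.imI h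
  have h2 := congrArg QuaternionAlgebra.imJ h
  have h3 := congrArg QuaternionAlgebra.imK h
  simp at h0 h1 h2 h3
  by_cases hr : I.re = 0
  · refine ⟨hr, ?_⟩
    rw [hr] at h0; linarith
  · have e1 : I.imI = 0 := mul_left_cancel₀ hr (by linarith)
    have e2 : I.imJ = 0 := mul_left_cancel₀ hr (by linarith)
    have e3 : I.imK = 0 := mul_left_cancel₀ hr (by linarith)
    rw [e1, e2, e3] at h0
    nlinarith [sq_nonneg I.re]

lemma usphere_mk {I : Quaternion ℝ} (h0 : I.re = 0)
    (h : I.imI ^ 2 + I.imJ ^ 2 + I.imK ^ 2 = 1) : I ∈ USphere := by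
  show I ^ 2 = -1
  rw [pow_two]
  ext <;> simp [h0] <;> linarith

def PP (I : Quaternion ℝ) : Quaternion ℝ := (1 / 2 : ℝ) • (1 - I * qI)
def QQ (I : Quaternion ℝ) : Quaternion ℝ := (1 / 2 : ℝ) • (1 + I * qI)

lemma norm_comb {I : Quaternion ℝ} (h : I ∈ USphere) (w v : ℂ) :
    ‖PP I * (w : Quaternion ℝ) + QQ I * (v : Quaternion ℝ)‖ ^ 2
      = (1 + I.imI) / 2 * ‖w‖ ^ 2 + (1 - I.imI) / 2 * ‖v‖ ^ 2 := by
  obtain ⟨h0, h1⟩ := usphere_iff h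
  rw [← Complex.normSq_eq_norm_sq, ← Complex.normSq_eq_norm_sq, pow_two,
    ← Quaternion.normSq_eq_norm_mul_self, Quaternion.normSq_def', Complex.normSq_apply,
    Complex.normSq_apply]
  simp [PP, QQ, h0]
  have : I.imK ^ 2 = 1 - I.imI ^ 2 - I.imJ ^ 2 := by linarith
  ring_nf
  rw [this]
  ring

lemma semi1 {I : Quaternion ℝ} (h : I ∈ USphere) (z : ℂ) :
    SemiconjBy (PP I) (z : Quaternion ℝ) ((z.re : Quaternion ℝ) + z.im • I) := by
  obtain ⟨h0, h1⟩ := usphere_iff h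
  have : I.imK ^ 2 = 1 - I.imI ^ 2 - I.imJ ^ 2 := by linarith
  show _ * _ = _ * _
  ext <;> simp [PP, h0] <;> ring_nf <;> (try rw [this]) <;> ring

lemma semi2 {I : Quaternion ℝ} (h : I ∈ USphere) (z : ℂ) :
    SemiconjBy (QQ I) ((starRingEnd ℂ z : ℂ) : Quaternion ℝ)
      ((z.re : Quaternion ℝ) + z.im • I) := by
  obtain ⟨h0, h1⟩ := usphere_iff h
  have : I.imK ^ 2 = 1 - I.imI ^ 2 - I.imJ ^ 2 := by linarith
  show _ * _ = _ * _
  ext <;> simp [QQ, h0] <;> ring_nf <;> (try rw [this]) <;> ring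

lemma pow_formula {I : Quaternion ℝ} (h : I ∈ USphere) (z w : ℂ) (n : ℕ) :
    ((z.re : Quaternion ℝ) + z.im • I) ^ n * (w : Quaternion ℝ)
      = PP I * ((z ^ n * w : ℂ) : Quaternion ℝ)
        + QQ I * (((starRingEnd ℂ z) ^ n * w : ℂ) : Quaternion ℝ) := by
  have e1 := ((semi1 h z).pow_right n).eq
  have e2 := ((semi2 h z).pow_right n).eq
  have e3 : PP I + QQ I = 1 := by
    simp only [PP, QQ, ← smul_add]; ext <;> simp <;> norm_num
  have c1 : ∀ u : ℂ, ((u ^ n * w : ℂ) : Quaternion ℝ)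
      = (u : Quaternion ℝ) ^ n * (w : Quaternion ℝ) := fun u => by
    have := map_mul Quaternion.ofComplex (u ^ n) w
    rw [map_pow] at this
    exact this
  rw [c1, c1, ← mul_assoc, ← mul_assoc, e1, e2, ← add_mul, ← mul_add, e3, mul_one]

lemma coeff_summable {c : ℕ → ℂ} (hc : CMemH2 c) {z : ℂ} (hz : ‖z‖ < 1) :
    Summable (fun n => z ^ n * c n) := by
  have ht : Tendsto (fun n => ‖c n‖ ^ 2) atTop (𝓝 0) := hc.tendsto_atTop_zero
  have hev : ∀ᶠ n in atTop, ‖c n‖ ^ 2 < 1 := ht.eventually (gt_mem_nhds one_pos)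
  refine Summable.of_norm_bounded_eventually_nat
    (summable_geometric_of_lt_one (norm_nonneg z) hz) ?_
  filter_upwards [hev] with n hn
  rw [norm_mul, norm_pow]
  have : ‖c n‖ ≤ 1 := by nlinarith [norm_nonneg (c n)]
  exact mul_le_of_le_one_right (by positivity) this

lemma continuous_coeC : Continuous (fun z : ℂ => (z : Quaternion ℝ)) := by
  have := Quaternion.ofComplex.toLinearMap.continuous_of_finiteDimensional
  exact this

lemma eval_formula {c : ℕ → ℂ} (hc : CMemH2 c) {I : Quaternion ℝ} (h : I ∈ USphere)
    {z : ℂ} (hz : ‖z‖ < 1) :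
    evalS (fun n => cToQ (c n)) ((z.re : Quaternion ℝ) + z.im • I)
      = PP I * (cEval c z : Quaternion ℝ)
        + QQ I * (cEval c (starRingEnd ℂ z) : Quaternion ℝ) := by
  have key : ∀ u : ℂ, ‖u‖ < 1 → HasSum (fun n => ((u ^ n * c n : ℂ) : Quaternion ℝ))
      (cEval c u : Quaternion ℝ) := fun u hu =>
    (coeff_summable hc hu).hasSum.map (Quaternion.ofComplex : ℂ →ₐ[ℝ] _) continuous_coeC
  have h1 := (key z hz).mul_left (PP I)
  have h2 := (key (starRingEnd ℂ z) (by simpa using hz)).mul_left (QQ I)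
  have h3 := h1.add h2
  unfold evalS
  rw [← h3.tsum_eq]
  congr 1
  funext n
  beta_reduce
  rw [cToQ_eq, pow_formula h]

/-- The point of the closed upper half plane representing `q`. -/
def upz (q : Quaternion ℝ) : ℂ := ⟨q.re, ‖q.im‖⟩

lemma norm_upz (q : Quaternion ℝ) : ‖upz q‖ = ‖q‖ := by
  have h1 : ‖upz q‖ ^ 2 = ‖q‖ ^ 2 := by
    rw [← Complex.normSq_eq_norm_sq, Complex.normSq_apply, pow_two ‖q‖,
      ← Quaternion.normSq_eq_norm_mul_self, Quaternion.normSq_def']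
    simp only [upz]
    rw [← Quaternion.normSq_eq_norm_mul_self, Quaternion.normSq_def']
    simp
    ring
  exact (pow_left_inj₀ (norm_nonneg _) (norm_nonneg _) two_ne_zero).1 h1

lemma exists_unit (q : Quaternion ℝ) :
    ∃ I ∈ USphere, q = ((upz q).re : Quaternion ℝ) + (upz q).im • I := by
  by_cases h : q.im = 0
  · refine ⟨qI, usphere_mk (by simp) (by simp), ?_⟩
    simp only [upz, h, norm_zero, zero_smul, add_zero]
    have := Quaternion.re_add_im q
    rw [h, add_zero] at this
    exact this.symm
  · have hn : ‖q.im‖ ≠ 0 := by simpa using h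
    refine ⟨‖q.im‖⁻¹ • q.im, usphere_mk (by simp) ?_, ?_⟩
    · have : ‖q.im‖ * ‖q.im‖ = q.imI ^ 2 + q.imJ ^ 2 + q.imK ^ 2 := by
        rw [← Quaternion.normSq_eq_norm_mul_self, Quaternion.normSq_def']; simp
      simp only [Quaternion.imI_smul, Quaternion.imJ_smul, Quaternion.imK_smul,
        Quaternion.imI_im, Quaternion.imJ_im, Quaternion.imK_im, smul_eq_mul, mul_pow,
        ← mul_add]
      rw [← this]
      field_simp
    · simp only [upz, smul_smul, mul_inv_cancel₀ hn, one_smul, Quaternion.re_add_im]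

lemma continuous_upz : Continuous upz := by
  have : upz = fun q => ((q.re : ℝ) : ℂ) + ((‖q.im‖ : ℝ) : ℂ) * Complex.I := by
    funext q; apply Complex.ext <;> simp [upz]
  rw [this]
  have h1 := Quaternion.continuous_re
  have h2 := Quaternion.continuous_im
  fun_prop

lemma bdval_norm {c : ℕ → ℂ} (hc : CMemH2 c) {q : Quaternion ℝ} (hq : ‖q‖ = 1)
    (h1 : ‖cBdval c (upz q)‖ = 1) (h2 : ‖cBdval c (starRingEnd ℂ (upz q))‖ = 1) :
    ‖bdval (fun n => cToQ (c n)) q‖ = 1 := by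
  have lim : ∀ z : ℂ, ‖cBdval c z‖ = 1 →
      Tendsto (fun r : ℝ => cEval c ((r : ℂ) * z)) (𝓝[<] (1 : ℝ)) (𝓝 (cBdval c z)) := by
    intro z hz
    by_cases h : ∃ L, Tendsto (fun r : ℝ => cEval c ((r : ℂ) * z)) (𝓝[<] (1 : ℝ)) (𝓝 L)
    · unfold cBdval
      rw [dif_pos h]
      exact h.choose_spec
    · unfold cBdval at hz
      rw [dif_neg h] at hz
      simp at hz
  obtain ⟨I, hI, hqI⟩ := exists_unit q
  have T1 := (((continuous_coeC.tendsto _).comp (lim _ h1)).const_mul (PP I)).add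
    (((continuous_coeC.tendsto _).comp (lim _ h2)).const_mul (QQ I))
  set L := PP I * (cBdval c (upz q) : Quaternion ℝ)
    + QQ I * (cBdval c (starRingEnd ℂ (upz q)) : Quaternion ℝ) with hL
  have T2 : Tendsto (fun r : ℝ => evalS (fun n => cToQ (c n)) ((r : Quaternion ℝ) * q))
      (𝓝[<] (1 : ℝ)) (𝓝 L) := by
    refine T1.congr' ?_
    have : ∀ᶠ r : ℝ in 𝓝[<] (1 : ℝ), r ∈ Set.Ioo (0 : ℝ) 1 :=
      Ioo_mem_nhdsLT one_pos
    filter_upwards [this] with r hr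
    have hz : ‖(r : ℂ) * upz q‖ < 1 := by
      rw [norm_mul, norm_upz, hq, mul_one, Complex.norm_real, Real.norm_eq_abs, abs_of_pos hr.1]
      exact hr.2
    have := eval_formula hc hI hz
    have e : (r : Quaternion ℝ) * q = (((r : ℂ) * upz q).re : Quaternion ℝ)
        + ((r : ℂ) * upz q).im • I := by
      conv_lhs => rw [hqI]
      simp [mul_add, smul_smul, Quaternion.coe_mul_eq_smul, mul_comm]
    rw [e, this]
    simp
  have hex : ∃ L, Tendsto (fun r : ℝ => evalS (fun n => cToQ (c n)) ((r : Quaternion ℝ) * q))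
      (𝓝[<] (1 : ℝ)) (𝓝 L) := ⟨L, T2⟩
  have hb : bdval (fun n => cToQ (c n)) q = L := by
    unfold bdval
    rw [dif_pos hex]
    exact tendsto_nhds_unique hex.choose_spec T2
  rw [hb]
  have := norm_comb hI (cBdval c (upz q)) (cBdval c (starRingEnd ℂ (upz q)))
  rw [← hL, h1, h2] at this
  have h3 : ‖L‖ ^ 2 = 1 := by rw [this]; ring
  exact (pow_eq_one_iff_of_nonneg (norm_nonneg _) two_ne_zero).1 h3

lemma ball_bound {c : ℕ → ℂ} (hc : CMemH2 c)
    (hbd : ∀ z ∈ Metric.ball (0 : ℂ) 1, ‖cEval c z‖ ≤ 1) {q : Quaternion ℝ} (hq : ‖q‖ < 1) :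
    ‖evalS (fun n => cToQ (c n)) q‖ ≤ 1 := by
  obtain ⟨I, hI, hqI⟩ := exists_unit q
  have hz : ‖upz q‖ < 1 := by rwa [norm_upz]
  have e := eval_formula hc hI hz
  rw [← hqI] at e
  have h1 := hbd (upz q) (by simpa using hz)
  have h2 := hbd (starRingEnd ℂ (upz q)) (by simpa using hz)
  have := norm_comb hI (cEval c (upz q)) (cEval c (starRingEnd ℂ (upz q)))
  rw [← e] at this
  obtain ⟨h0, hs⟩ := usphere_iff hI
  have ha : |I.imI| ≤ 1 := by
    rw [← sq_le_one_iff_abs_le_one]; nlinarith [sq_nonneg I.imJ, sq_nonneg I.imK]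
  obtain ⟨ha1, ha2⟩ := abs_le.1 ha
  have g1 := pow_le_one₀ (n := 2) (norm_nonneg _) h1
  have g2 := pow_le_one₀ (n := 2) (norm_nonneg _) h2
  have : ‖evalS (fun n => cToQ (c n)) q‖ ^ 2 ≤ 1 := by
    rw [this]
    nlinarith [mul_le_mul_of_nonneg_left g1 (by linarith : 0 ≤ (1 + I.imI) / 2),
      mul_le_mul_of_nonneg_left g2 (by linarith : 0 ≤ (1 - I.imI) / 2)]
  exact (pow_le_one_iff_of_nonneg (norm_nonneg _) two_ne_zero).1 this

lemma usphere_meas : MeasurableSet USphere := by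
  have : IsClosed USphere := isClosed_eq (by fun_prop) (by fun_prop)
  exact this.measurableSet

instance sph_finite : IsFiniteMeasure sphMeasure := by
  refine ⟨?_⟩
  simp only [sphMeasure, Measure.smul_apply, Measure.restrict_apply_univ, smul_eq_mul]
  exact (ENNReal.inv_mul_le_one _).trans_lt ENNReal.one_lt_top

lemma sph_ae : ∀ᵐ I ∂sphMeasure, I ∈ USphere :=
  Measure.ae_smul_measure (ae_restrict_mem usphere_meas) _

lemma upz_ptOn {I : Quaternion ℝ} (hI : I ∈ USphere) (t : ℝ) :
    ‖ptOn I t‖ = 1 ∧ (upz (ptOn I t) = Complex.exp (t * Complex.I) ∨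
      upz (ptOn I t) = starRingEnd ℂ (Complex.exp (t * Complex.I))) := by
  obtain ⟨h0, hs⟩ := usphere_iff hI
  have him : ‖(ptOn I t).im‖ = |Real.sin t| := by
    have : ‖(ptOn I t).im‖ ^ 2 = |Real.sin t| ^ 2 := by
      rw [pow_two, ← Quaternion.normSq_eq_norm_mul_self, Quaternion.normSq_def', sq_abs]
      simp [ptOn, -Complex.ofReal_cos, -Complex.ofReal_sin]
      linear_combination (Real.sin t) ^ 2 * hs
    exact (pow_left_inj₀ (norm_nonneg _) (abs_nonneg _) two_ne_zero).1 this
  have hre : (ptOn I t).re = Real.cos t := by simp [ptOn, h0]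
  have hu : upz (ptOn I t) = ⟨Real.cos t, |Real.sin t|⟩ := by
    unfold upz; rw [him, hre]
  constructor
  · rw [← norm_upz, hu]
    have : ‖(⟨Real.cos t, |Real.sin t|⟩ : ℂ)‖ ^ 2 = 1 := by
      rw [← Complex.normSq_eq_norm_sq, Complex.normSq_apply]
      simp only [abs_mul_abs_self]
      nlinarith [Real.sin_sq_add_cos_sq t]
    exact (pow_eq_one_iff_of_nonneg (norm_nonneg _) two_ne_zero).1 this
  · rw [hu]
    rcases le_total 0 (Real.sin t) with h | h
    · left
      rw [abs_of_nonneg h]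
      apply Complex.ext <;> simp [Complex.exp_ofReal_mul_I_re, Complex.exp_ofReal_mul_I_im]
    · right
      rw [abs_of_nonpos h]
      apply Complex.ext <;> simp [Complex.exp_ofReal_mul_I_re, Complex.exp_ofReal_mul_I_im]

lemma exp_ae {N : Set ℂ} (hN : circleM N = 0) (hNm : MeasurableSet N) :
    ∀ᵐ t ∂(volume.restrict (Set.Ico 0 (2 * Real.pi))),
      Complex.exp ((t : ℝ) * Complex.I) ∉ N ∧
        starRingEnd ℂ (Complex.exp ((t : ℝ) * Complex.I)) ∉ N := by
  have hmeas : Measurable (fun t : ℝ => Complex.exp (t * Complex.I)) := by fun_prop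
  have h1 : ∀ᵐ t ∂(volume.restrict (Set.Ico 0 (2 * Real.pi))),
      Complex.exp ((t : ℝ) * Complex.I) ∉ N := by
    have : ∀ᵐ z ∂circleM, z ∉ N := measure_eq_zero_iff_ae_notMem.1 hN
    exact ae_of_ae_map hmeas.aemeasurable this
  refine h1.and ?_
  have h2 := (ae_restrict_iff' measurableSet_Ico).1 h1
  have h3 := (Measure.measurePreserving_sub_left (volume : Measure ℝ)
    (2 * Real.pi)).quasiMeasurePreserving.ae h2
  rw [ae_restrict_iff' measurableSet_Ico]
  have h0 : ∀ᵐ t : ℝ, t ≠ 0 := by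
    simp [ae_iff]
  filter_upwards [h3, h0] with t ht ht0 hmem
  have := ht ⟨by linarith [hmem.2], by
    have := lt_of_le_of_ne hmem.1 (Ne.symm ht0); linarith⟩
  convert this using 2
  rw [← Complex.exp_conj]
  push_cast
  rw [sub_mul, Complex.exp_sub, Complex.exp_two_pi_mul_I, one_div, ← Complex.exp_neg]
  simp

theorem ext_of_complex_inner_is_inner (c : ℕ → ℂ) (hc : CMemH2 c)
    (hbd : ∀ z ∈ Metric.ball (0 : ℂ) 1, ‖cEval c z‖ ≤ 1)
    (hmod : ∀ᵐ z ∂circleM, ‖cBdval c z‖ = 1) :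
    IsInnerQ (fun n => cToQ (c n)) := by
  refine ⟨?_, fun q hq => ball_bound hc hbd hq, ?_⟩
  · unfold MemH2
    refine hc.congr fun n => ?_
    beta_reduce
    rw [cToQ_eq, pow_two ‖(c n : Quaternion ℝ)‖, ← Quaternion.normSq_eq_norm_mul_self,
      Quaternion.normSq_def', ← Complex.normSq_eq_norm_sq, Complex.normSq_apply]
    simp
    ring
  obtain ⟨N, hsub, hNm, hN⟩ := exists_measurable_superset_of_null (ae_iff.1 hmod)
  have hgood : ∀ z, z ∉ N → ‖cBdval c z‖ = 1 := fun z hz => by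
    by_contra h
    exact hz (hsub h)
  have hmap : Measurable (fun p : ℝ × Quaternion ℝ => ptOn p.2 p.1) := by
    have : Continuous (fun p : ℝ × Quaternion ℝ => ptOn p.2 p.1) := by
      unfold ptOn
      have := Quaternion.continuous_coe
      fun_prop
    exact this.measurable
  have hG : MeasurableSet {q : Quaternion ℝ | ‖q‖ = 1 ∧ upz q ∉ N ∧
      starRingEnd ℂ (upz q) ∉ N} := by
    refine (measurableSet_eq_fun (by fun_prop) (by fun_prop)).inter ?_
    exact (continuous_upz.measurable hNm.compl).inter
      ((Complex.continuous_conj.comp continuous_upz).measurable hNm.compl)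
  have hmain : ∀ᵐ q ∂SigmaBd, q ∈ {q : Quaternion ℝ | ‖q‖ = 1 ∧ upz q ∉ N ∧
      starRingEnd ℂ (upz q) ∉ N} := by
    refine Measure.ae_smul_measure ?_ _
    refine (ae_map_iff hmap.aemeasurable hG).2 ?_
    have a1 := Measure.quasiMeasurePreserving_fst
      (μ := volume.restrict (Set.Ico 0 (2 * Real.pi))) (ν := sphMeasure) |>.ae (exp_ae hN hNm)
    have a2 := Measure.quasiMeasurePreserving_snd
      (μ := volume.restrict (Set.Ico 0 (2 * Real.pi))) (ν := sphMeasure) |>.ae sph_ae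
    filter_upwards [a1, a2] with p hp1 hp2
    obtain ⟨hn, h | h⟩ := upz_ptOn hp2 p.1
    · refine ⟨hn, ?_⟩
      rw [h]; exact hp1
    · refine ⟨hn, ?_⟩
      rw [h, Complex.conj_conj]; exact hp1.symm
  filter_upwards [hmain] with q hq
  exact bdval_norm hc hq.1 (hgood _ hq.2.1) (hgood _ hq.2.2)

end ExtInner
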